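/- arXiv:2411.04463 — 3 statements merged into one kernel-verified Lean document; each statement's English description precedes it below -/
import Mathlib

section
/- Let G be a group. Then G is amenable (i.e. there exists a G-invariant mean on ℓ∞(G)) if and only if ℓ∞(G) ≠ 𝓘̄, where 𝓘̄ is the closure, in the weak topology of the Banach space ℓ∞(G), of the linear span 𝓘 of the set {φ − g·φ : g ∈ G, φ ∈ ℓ∞(G)}. -/
/-!
Setting: for a group `G`, the Banach space `ℓ∞(G)` of bounded real-valued functions on `G`
is realized as `lp (fun _ : G => ℝ) ∞`.  `G` acts on `ℓ∞(G)` by `(g·φ)(x) = φ(xg)`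
(`rTranslate g φ`), `𝓘` (`Ispan G`) is the linear span of `{φ - g·φ}`, and `weakClosure`
is the closure in the weak topology of `ℓ∞(G)`.
-/

open scoped ENNReal

noncomputable section

/-- The action of `G` on `ℓ∞(G)`: `(g·φ)(x) = φ(xg)`. -/
def rTranslate {G : Type*} [Group G] (g : G) (φ : lp (fun _ : G => ℝ) ∞) :
    lp (fun _ : G => ℝ) ∞ :=
  ⟨fun x => φ (x * g), by
    refine memℓp_infty ?_
    obtain ⟨M, hM⟩ := memℓp_infty_iff.mp (lp.memℓp φ)
    exact ⟨M, by rintro y ⟨x, rfl⟩; exact hM ⟨x * g, rfl⟩⟩⟩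

/-- `𝓘`: the linear span of `{φ - g·φ : g ∈ G, φ ∈ ℓ∞(G)}` in `ℓ∞(G)`. -/
def Ispan (G : Type*) [Group G] : Submodule ℝ (lp (fun _ : G => ℝ) ∞) :=
  Submodule.span ℝ {ψ | ∃ (g : G) (φ : lp (fun _ : G => ℝ) ∞), ψ = φ - rTranslate g φ}

/-- The closure of a subset of `ℓ∞(G)` in the weak topology (the topology induced by the
continuous dual of `ℓ∞(G)`). -/
def weakClosure (G : Type*) (S : Set (lp (fun _ : G => ℝ) ∞)) :
    Set (lp (fun _ : G => ℝ) ∞) :=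
  closure (X := WeakSpace ℝ (lp (fun _ : G => ℝ) ∞)) S

/-- A `G`-invariant mean on `ℓ∞(G)`: a positive linear map `μ : ℓ∞(G) → ℝ` with `μ(𝟙) = 1`
and `μ(g·φ) = μ(φ)` for all `g` and `φ`. -/
structure IsInvariantMean (G : Type*) [Group G] (μ : lp (fun _ : G => ℝ) ∞ → ℝ) : Prop where
  map_add : ∀ φ ψ, μ (φ + ψ) = μ φ + μ ψ
  map_smul : ∀ (c : ℝ) (φ), μ (c • φ) = c * μ φ
  pos : ∀ φ, (∀ x, 0 ≤ φ x) → 0 ≤ μ φ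
  map_one : μ 1 = 1
  invariant : ∀ (g : G) (φ), μ (rTranslate g φ) = μ φ

local notation "ℓ∞(" G ")" => lp (fun _ : G => ℝ) ∞

section TranslationAction

variable {G : Type*} [Group G]

@[simp]
theorem rTranslate_apply (g : G) (φ : ℓ∞(G)) (x : G) : rTranslate g φ x = φ (x * g) := rfl

theorem rTranslate_sub (g : G) (φ ψ : ℓ∞(G)) :
    rTranslate g (φ - ψ) = rTranslate g φ - rTranslate g ψ := rfl

@[simp]
theorem rTranslate_inv_rTranslate (g : G) (φ : ℓ∞(G)) :
    rTranslate g⁻¹ (rTranslate g φ) = φ := by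
  ext x
  simp

end TranslationAction

section WeakClosure

variable {G : Type*}

/-- By Mazur's theorem the weak closure of a subspace is its norm closure. -/
theorem weakClosure_submodule (S : Submodule ℝ ℓ∞(G)) :
    weakClosure G (S : Set ℓ∞(G)) = closure (S : Set ℓ∞(G)) := by
  have h := S.convex.toWeakSpace_closure ℝ
  have hid : ∀ s : Set ℓ∞(G), toWeakSpace ℝ ℓ∞(G) '' s = s := fun s => Set.image_id s
  rw [hid, hid] at h
  exact h.symm

end WeakClosure

/-- A point outside the closure of a subspace is separated from it by a continuous linear
functional vanishing on the subspace. -/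
theorem Submodule.exists_strongDual_eq_zero_of_notMem_closure {E : Type*} [NormedAddCommGroup E]
    [NormedSpace ℝ E] (S : Submodule ℝ E) {x : E} (hx : x ∉ closure (S : Set E)) :
    ∃ f : E →L[ℝ] ℝ, (∀ y ∈ S, f y = 0) ∧ f x ≠ 0 := by
  obtain ⟨f, u, hfx, hfS⟩ :=
    geometric_hahn_banach_point_closed S.convex.closure isClosed_closure hx
  have hzero : ∀ y ∈ S, f y = 0 := by
    intro y hy
    by_contra hne
    have := hfS _ (subset_closure (S.smul_mem ((u - 1) / f y) hy))
    rw [map_smul, smul_eq_mul, div_mul_cancel₀ _ hne] at this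
    linarith
  refine ⟨f, hzero, fun h0 => ?_⟩
  have := hfS 0 (subset_closure S.zero_mem)
  rw [map_zero] at this
  linarith

section PositivePart

variable {G : Type*}

theorem lp_infty_apply_le_norm (φ : ℓ∞(G)) (x : G) : φ x ≤ ‖φ‖ :=
  (le_abs_self _).trans (lp.norm_apply_le_norm ENNReal.top_ne_zero φ x)

theorem lp_infty_neg_norm_le_apply (φ : ℓ∞(G)) (x : G) : -‖φ‖ ≤ φ x :=
  neg_le_of_abs_le (lp.norm_apply_le_norm ENNReal.top_ne_zero φ x)

theorem add_norm_smul_one_nonneg (φ : ℓ∞(G)) (x : G) :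
    0 ≤ (φ + ‖φ‖ • (1 : ℓ∞(G))) x := by
  have := lp_infty_neg_norm_le_apply φ x
  change 0 ≤ φ x + ‖φ‖ * 1
  linarith

theorem norm_smul_one_nonneg (φ : ℓ∞(G)) (x : G) : 0 ≤ (‖φ‖ • (1 : ℓ∞(G))) x := by
  simp [lp.infty_coeFn_one]

/-- The pointwise minimum of two bounded functions. -/
def lpInftyMin (φ ψ : ℓ∞(G)) : ℓ∞(G) :=
  ⟨fun x => min (φ x) (ψ x), memℓp_infty ⟨max ‖φ‖ ‖ψ‖, by
    rintro _ ⟨x, rfl⟩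
    exact abs_min_le_max_abs_abs.trans
      (max_le_max (lp.norm_apply_le_norm ENNReal.top_ne_zero φ x)
        (lp.norm_apply_le_norm ENNReal.top_ne_zero ψ x))⟩⟩

/-- The positive part of a functional on the positive cone of `ℓ∞(G)`:
the supremum of `f` over the order interval `[0, φ]`. -/
def posPartCone (f : ℓ∞(G) →L[ℝ] ℝ) (φ : ℓ∞(G)) : ℝ :=
  sSup {r | ∃ ψ : ℓ∞(G), (∀ x, 0 ≤ ψ x ∧ ψ x ≤ φ x) ∧ f ψ = r}

variable (f : ℓ∞(G) →L[ℝ] ℝ) {φ ψ : ℓ∞(G)}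

theorem le_posPartCone (h : ∀ x, 0 ≤ ψ x ∧ ψ x ≤ φ x) : f ψ ≤ posPartCone f φ := by
  refine le_csSup ⟨‖f‖ * ‖φ‖, ?_⟩ ⟨ψ, h, rfl⟩
  rintro _ ⟨χ, hχ, rfl⟩
  have hnorm : ‖χ‖ ≤ ‖φ‖ := lp.norm_le_of_forall_le (norm_nonneg _) fun x => by
    rw [Real.norm_of_nonneg (hχ x).1]
    exact (hχ x).2.trans (lp_infty_apply_le_norm φ x)
  exact (le_abs_self _).trans (f.le_of_opNorm_le_of_le le_rfl hnorm)

theorem posPartCone_le (hφ : ∀ x, 0 ≤ φ x) {r : ℝ}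
    (h : ∀ ψ : ℓ∞(G), (∀ x, 0 ≤ ψ x ∧ ψ x ≤ φ x) → f ψ ≤ r) : posPartCone f φ ≤ r := by
  refine csSup_le ⟨f 0, 0, fun x => ⟨le_rfl, hφ x⟩, rfl⟩ ?_
  rintro _ ⟨ψ, hψ, rfl⟩
  exact h ψ hψ

theorem posPartCone_nonneg (hφ : ∀ x, 0 ≤ φ x) : 0 ≤ posPartCone f φ := by
  simpa using le_posPartCone f (ψ := 0) fun x => ⟨le_rfl, hφ x⟩

theorem posPartCone_zero : posPartCone f 0 = 0 := by
  refine le_antisymm (posPartCone_le f (fun _ => le_rfl) fun ψ hψ => ?_)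
    (posPartCone_nonneg f fun _ => le_rfl)
  have : ψ = 0 := by
    ext x
    exact le_antisymm (hψ x).2 (hψ x).1
  simp [this]

theorem posPartCone_add (hφ : ∀ x, 0 ≤ φ x) (hψ : ∀ x, 0 ≤ ψ x) :
    posPartCone f (φ + ψ) = posPartCone f φ + posPartCone f ψ := by
  apply le_antisymm
  · refine posPartCone_le f (fun x => add_nonneg (hφ x) (hψ x)) fun χ hχ => ?_
    have h₁ := le_posPartCone f (ψ := lpInftyMin χ φ) (φ := φ) fun x =>
      ⟨le_min (hχ x).1 (hφ x), min_le_right _ _⟩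
    have h₂ := le_posPartCone f (ψ := χ - lpInftyMin χ φ) (φ := ψ) fun x => by
      have h : χ x ≤ φ x + ψ x := (hχ x).2
      have := hψ x
      change 0 ≤ χ x - min (χ x) (φ x) ∧ χ x - min (χ x) (φ x) ≤ ψ x
      rcases min_cases (χ x) (φ x) with h' | h' <;> constructor <;> linarith
    rw [map_sub] at h₂
    linarith
  · rw [← le_sub_iff_add_le]
    refine posPartCone_le f hφ fun χ hχ => ?_
    rw [le_sub_comm]
    refine posPartCone_le f hψ fun ω hω => ?_
    have := le_posPartCone f (ψ := χ + ω) (φ := φ + ψ) fun x =>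
      ⟨add_nonneg (hχ x).1 (hω x).1, add_le_add (hχ x).2 (hω x).2⟩
    rw [map_add] at this
    linarith

theorem posPartCone_smul (hφ : ∀ x, 0 ≤ φ x) {c : ℝ} (hc : 0 ≤ c) :
    posPartCone f (c • φ) = c * posPartCone f φ := by
  rcases hc.eq_or_lt with rfl | hc
  · simp [posPartCone_zero]
  have key : ∀ {d : ℝ} {χ : ℓ∞(G)}, 0 < d → (∀ x, 0 ≤ χ x) →
      d * posPartCone f χ ≤ posPartCone f (d • χ) := by
    intro d χ hd hχ
    rw [← le_div_iff₀' hd]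
    refine posPartCone_le f hχ fun ω hω => ?_
    rw [le_div_iff₀' hd, ← smul_eq_mul, ← map_smul]
    exact le_posPartCone f fun x =>
      ⟨mul_nonneg hd.le (hω x).1, mul_le_mul_of_nonneg_left (hω x).2 hd.le⟩
  refine le_antisymm ?_ (key hc hφ)
  have h := key (inv_pos.2 hc) (χ := c • φ) fun x => mul_nonneg hc.le (hφ x)
  rwa [inv_smul_smul₀ hc.ne', inv_mul_le_iff₀ hc] at h

/-- The extension of `posPartCone f` from the positive cone to all of `ℓ∞(G)`. -/
def dualPosPart (φ : ℓ∞(G)) : ℝ :=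
  posPartCone f (φ + ‖φ‖ • 1) - posPartCone f (‖φ‖ • 1)

theorem dualPosPart_sub (hφ : ∀ x, 0 ≤ φ x) (hψ : ∀ x, 0 ≤ ψ x) :
    dualPosPart f (φ - ψ) = posPartCone f φ - posPartCone f ψ := by
  have h₁ := posPartCone_add f (add_norm_smul_one_nonneg (φ - ψ)) hψ
  have h₂ := posPartCone_add f hφ (norm_smul_one_nonneg (φ - ψ))
  rw [show φ - ψ + ‖φ - ψ‖ • 1 + ψ = φ + ‖φ - ψ‖ • 1 by abel] at h₁
  rw [dualPosPart]
  linarith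

theorem dualPosPart_of_nonneg (hφ : ∀ x, 0 ≤ φ x) : dualPosPart f φ = posPartCone f φ := by
  simpa [posPartCone_zero] using dualPosPart_sub f (ψ := 0) hφ fun _ => le_rfl

theorem exists_nonneg_sub_eq (φ : ℓ∞(G)) :
    ∃ α β : ℓ∞(G), (∀ x, 0 ≤ α x) ∧ (∀ x, 0 ≤ β x) ∧ φ = α - β :=
  ⟨_, _, add_norm_smul_one_nonneg φ, norm_smul_one_nonneg φ, (add_sub_cancel_right _ _).symm⟩

theorem dualPosPart_add (φ ψ : ℓ∞(G)) :
    dualPosPart f (φ + ψ) = dualPosPart f φ + dualPosPart f ψ := by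
  obtain ⟨α, β, hα, hβ, rfl⟩ := exists_nonneg_sub_eq φ
  obtain ⟨γ, δ, hγ, hδ, rfl⟩ := exists_nonneg_sub_eq ψ
  rw [sub_add_sub_comm, dualPosPart_sub f hα hβ, dualPosPart_sub f hγ hδ,
    dualPosPart_sub f (fun x => add_nonneg (hα x) (hγ x)) (fun x => add_nonneg (hβ x) (hδ x)),
    posPartCone_add f hα hγ, posPartCone_add f hβ hδ]
  ring

theorem dualPosPart_smul (c : ℝ) (φ : ℓ∞(G)) : dualPosPart f (c • φ) = c * dualPosPart f φ := by
  obtain ⟨α, β, hα, hβ, rfl⟩ := exists_nonneg_sub_eq φ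
  rw [dualPosPart_sub f hα hβ]
  rcases le_total 0 c with hc | hc
  · rw [smul_sub, dualPosPart_sub f (fun x => mul_nonneg hc (hα x))
      (fun x => mul_nonneg hc (hβ x)), posPartCone_smul f hα hc, posPartCone_smul f hβ hc]
    ring
  · have hc' : 0 ≤ -c := neg_nonneg.2 hc
    rw [show c • (α - β) = (-c) • β - (-c) • α by module,
      dualPosPart_sub f (fun x => mul_nonneg hc' (hβ x)) (fun x => mul_nonneg hc' (hα x)),
      posPartCone_smul f hα hc', posPartCone_smul f hβ hc']
    ring

theorem posPartCone_one_pos (hψ : ∀ x, 0 ≤ ψ x) (hf : 0 < f ψ) : 0 < posPartCone f 1 := by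
  have hnorm : 0 < ‖ψ‖ := norm_pos_iff.2 fun h => by simp [h] at hf
  have h := le_posPartCone f (φ := ‖ψ‖ • 1) fun x =>
    ⟨hψ x, by simpa [lp.infty_coeFn_one] using lp_infty_apply_le_norm ψ x⟩
  rw [posPartCone_smul f (by simp [lp.infty_coeFn_one]) hnorm.le] at h
  exact pos_of_mul_pos_right (hf.trans_le h) hnorm.le

end PositivePart

section InvariantMean

variable {G : Type*} [Group G]

theorem posPartCone_rTranslate {f : ℓ∞(G) →L[ℝ] ℝ}
    (hf : ∀ (g : G) (φ : ℓ∞(G)), f (rTranslate g φ) = f φ) (g : G) {φ : ℓ∞(G)}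
    (hφ : ∀ x, 0 ≤ φ x) : posPartCone f (rTranslate g φ) = posPartCone f φ := by
  have key : ∀ (h : G) {χ : ℓ∞(G)}, (∀ x, 0 ≤ χ x) →
      posPartCone f χ ≤ posPartCone f (rTranslate h χ) := fun h χ hχ =>
    posPartCone_le f hχ fun ω hω => by
      rw [← hf h ω]
      exact le_posPartCone f fun x => hω (x * h)
  refine le_antisymm ?_ (key g hφ)
  simpa using key g⁻¹ (χ := rTranslate g φ) fun x => hφ (x * g)

theorem dualPosPart_rTranslate {f : ℓ∞(G) →L[ℝ] ℝ}
    (hf : ∀ (g : G) (φ : ℓ∞(G)), f (rTranslate g φ) = f φ) (g : G) (φ : ℓ∞(G)) :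
    dualPosPart f (rTranslate g φ) = dualPosPart f φ := by
  obtain ⟨α, β, hα, hβ, rfl⟩ := exists_nonneg_sub_eq φ
  rw [rTranslate_sub, dualPosPart_sub f (fun x => hα (x * g)) (fun x => hβ (x * g)),
    dualPosPart_sub f hα hβ, posPartCone_rTranslate hf g hα, posPartCone_rTranslate hf g hβ]

/-- An invariant functional taking a positive value at a nonnegative function yields an
invariant mean, namely its normalized positive part. -/
theorem exists_isInvariantMean_of_pos {f : ℓ∞(G) →L[ℝ] ℝ}
    (hf : ∀ (g : G) (φ : ℓ∞(G)), f (rTranslate g φ) = f φ) {ψ : ℓ∞(G)}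
    (hψ : ∀ x, 0 ≤ ψ x) (hpos : 0 < f ψ) : ∃ μ : ℓ∞(G) → ℝ, IsInvariantMean G μ := by
  have hone := posPartCone_one_pos f hψ hpos
  refine ⟨fun φ => dualPosPart f φ / posPartCone f 1, ?_, ?_, ?_, ?_, ?_⟩
  · intro φ χ
    rw [dualPosPart_add, add_div]
  · intro c φ
    rw [dualPosPart_smul, mul_div_assoc]
  · intro φ hφ
    rw [dualPosPart_of_nonneg f hφ]
    exact div_nonneg (posPartCone_nonneg f hφ) hone.le
  · rw [dualPosPart_of_nonneg f (by simp [lp.infty_coeFn_one]), div_self hone.ne']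
  · intro g φ
    rw [dualPosPart_rTranslate hf]

theorem exists_isInvariantMean_of_ne_zero {f : ℓ∞(G) →L[ℝ] ℝ}
    (hf : ∀ (g : G) (φ : ℓ∞(G)), f (rTranslate g φ) = f φ) {φ : ℓ∞(G)} (hφ : f φ ≠ 0) :
    ∃ μ : ℓ∞(G) → ℝ, IsInvariantMean G μ := by
  obtain ⟨ψ, hψ, hne⟩ : ∃ ψ : ℓ∞(G), (∀ x, 0 ≤ ψ x) ∧ f ψ ≠ 0 := by
    by_contra! h
    obtain ⟨α, β, hα, hβ, rfl⟩ := exists_nonneg_sub_eq φ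
    exact hφ (by rw [map_sub, h α hα, h β hβ, sub_zero])
  rcases hne.lt_or_gt with hneg | hpos
  · exact exists_isInvariantMean_of_pos (f := -f) (fun g χ => congrArg Neg.neg (hf g χ)) hψ
      (neg_pos.2 hneg)
  · exact exists_isInvariantMean_of_pos hf hψ hpos

namespace IsInvariantMean

variable {μ : ℓ∞(G) → ℝ}

theorem le_norm (hμ : IsInvariantMean G μ) (φ : ℓ∞(G)) : μ φ ≤ ‖φ‖ := by
  have h := hμ.pos (‖φ‖ • 1 + (-1 : ℝ) • φ) fun x => by
    have := lp_infty_apply_le_norm φ x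
    change 0 ≤ ‖φ‖ * 1 + -1 * φ x
    linarith
  rw [hμ.map_add, hμ.map_smul, hμ.map_smul, hμ.map_one] at h
  linarith

/-- An invariant mean as a continuous linear functional. -/
def toStrongDual (hμ : IsInvariantMean G μ) : ℓ∞(G) →L[ℝ] ℝ :=
  LinearMap.mkContinuous ⟨⟨μ, hμ.map_add⟩, hμ.map_smul⟩ 1 fun φ => by
    have h := hμ.le_norm ((-1 : ℝ) • φ)
    rw [hμ.map_smul, norm_smul, norm_neg, norm_one, one_mul] at h
    rw [one_mul]
    exact abs_le.2 ⟨show -‖φ‖ ≤ μ φ by linarith, hμ.le_norm φ⟩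

theorem toStrongDual_apply (hμ : IsInvariantMean G μ) (φ : ℓ∞(G)) : hμ.toStrongDual φ = μ φ :=
  rfl

theorem closure_Ispan_subset_ker (hμ : IsInvariantMean G μ) :
    closure (Ispan G : Set ℓ∞(G)) ⊆ {φ | hμ.toStrongDual φ = 0} := by
  refine closure_minimal ?_ (isClosed_eq hμ.toStrongDual.continuous continuous_const)
  have hle : Ispan G ≤ hμ.toStrongDual.toLinearMap.ker := by
    refine Submodule.span_le.2 ?_
    rintro _ ⟨g, φ, rfl⟩
    change hμ.toStrongDual (φ - rTranslate g φ) = 0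
    rw [map_sub, toStrongDual_apply, toStrongDual_apply, hμ.invariant, sub_self]
  exact fun φ hφ => hle hφ

end IsInvariantMean

end InvariantMean

theorem stmt7 (G : Type*) [Group G] :
    (∃ μ : lp (fun _ : G => ℝ) ∞ → ℝ, IsInvariantMean G μ) ↔
      weakClosure G (Ispan G : Set (lp (fun _ : G => ℝ) ∞)) ≠ Set.univ := by
  rw [weakClosure_submodule]
  constructor
  · rintro ⟨μ, hμ⟩ huniv
    have h : hμ.toStrongDual 1 = 0 := hμ.closure_Ispan_subset_ker (huniv ▸ Set.mem_univ _)
    rw [hμ.toStrongDual_apply, hμ.map_one] at h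
    exact one_ne_zero h
  · intro hne
    obtain ⟨φ, hφ⟩ := (Set.ne_univ_iff_exists_notMem _).1 hne
    obtain ⟨f, hf, hfφ⟩ := (Ispan G).exists_strongDual_eq_zero_of_notMem_closure hφ
    refine exists_isInvariantMean_of_ne_zero (fun g ψ => ?_) hfφ
    have := hf (ψ - rTranslate g ψ) (Submodule.subset_span ⟨g, ψ, rfl⟩)
    rw [map_sub] at this
    linarith
end
end

section
/- Let G be a group with a left-invariant metric d whose balls B_m = {g ∈ G : d(g,1) ≤ m} are finite and satisfy |B_m| ≤ e^{Cm} for all m ∈ ℕ, for some C > 0, and let F : G × G → ℝ satisfy |F(g,h)| ≤ C₁ e^{−C₂ d(g,h)²} for all g, h ∈ G, for some C₁, C₂ > 0. Define F₁, F₂ ∈ ℓ∞(G) by F₁(g) = ∑_{h∈G} F(h,g) and F₂(g) = ∑_{h∈G} F(g,h). Then F₁ and F₂ are well-defined bounded functions and F₁ − F₂ lies in 𝓘̂, the closure of 𝓘 in the supremum-norm topology of ℓ∞(G). -/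
/-!
Setting: for a group `G`, the Banach space `ℓ∞(G)` of bounded real-valued functions on `G`
is realized as `lp (fun _ : G => ℝ) ∞`.  `G` acts on `ℓ∞(G)` by `(g·φ)(x) = φ(xg)`
(`rTranslate g φ`), `𝓘` (`Ispan G`) is the linear span of `{φ - g·φ}`, and `weakClosure`
is the closure in the weak topology of `ℓ∞(G)`.
-/

open scoped ENNReal

noncomputable section

/-- A Gaussian in the distance to `1` is summable when balls grow at most exponentially. -/
lemma summable_exp_neg_mul_dist_one_sq {G : Type*} [One G] [PseudoMetricSpace G]
    (hballfin : ∀ m : ℕ, (Metric.closedBall (1 : G) m).Finite) {C : ℝ} (hC : 0 < C)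
    (hgrowth : ∀ m : ℕ, (Nat.card (Metric.closedBall (1 : G) m) : ℝ) ≤ Real.exp (C * m))
    {c : ℝ} (hc : 0 < c) :
    Summable fun k : G => Real.exp (-c * dist 1 k ^ 2) := by
  classical
  set n : G → ℕ := fun k => ⌈dist 1 k⌉₊
  set K : ℝ := (C + 1) + (C + 1) ^ 2 / (4 * c) with hK
  have hgeom : Summable fun m : ℕ => Real.exp (-(m : ℝ)) := Real.summable_exp_neg_nat
  have hgauss : ∀ k : G, Real.exp (-c * dist 1 k ^ 2) ≤ Real.exp (K - (C + 1) * n k) := by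
    intro k
    rw [Real.exp_le_exp]
    have hceil : (n k : ℝ) ≤ dist 1 k + 1 := (Nat.ceil_lt_add_one dist_nonneg).le
    have hmul : (C + 1) * n k ≤ (C + 1) * (dist 1 k + 1) := by gcongr
    have hsq : (C + 1) ^ 2 / (4 * c) + c * dist 1 k ^ 2 - (C + 1) * dist 1 k
        = c * (dist 1 k - (C + 1) / (2 * c)) ^ 2 := by
      field_simp
      ring
    have hnonneg : 0 ≤ c * (dist 1 k - (C + 1) / (2 * c)) ^ 2 := by positivity
    linarith
  have hfiber : ∀ (s : Finset G) (m : ℕ), ((s.filter fun k => n k = m).card : ℝ)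
      ≤ Real.exp (C * m) := by
    intro s m
    refine le_trans ?_ (hgrowth m)
    rw [Nat.card_coe_set_eq]
    norm_cast
    rw [← Set.ncard_coe_finset]
    refine Set.ncard_le_ncard ?_ (hballfin m)
    intro k hk
    have hkm : n k = m := (Finset.mem_filter.mp hk).2
    rw [Metric.mem_closedBall, dist_comm, ← hkm]
    exact Nat.le_ceil _
  refine summable_of_sum_le (c := Real.exp K * ∑' m : ℕ, Real.exp (-(m : ℝ)))
    (fun k => (Real.exp_pos _).le) fun s => ?_
  calc ∑ k ∈ s, Real.exp (-c * dist 1 k ^ 2)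
      ≤ ∑ k ∈ s, Real.exp (K - (C + 1) * n k) := Finset.sum_le_sum fun k _ => hgauss k
    _ = ∑ m ∈ s.image n, ∑ k ∈ s with n k = m, Real.exp (K - (C + 1) * n k) :=
        (Finset.sum_fiberwise_of_maps_to (fun k hk => Finset.mem_image_of_mem n hk) _).symm
    _ ≤ ∑ m ∈ s.image n, Real.exp K * Real.exp (-(m : ℝ)) := by
        refine Finset.sum_le_sum fun m _ => ?_
        calc ∑ k ∈ s with n k = m, Real.exp (K - (C + 1) * n k)
            = ∑ k ∈ s with n k = m, Real.exp (K - (C + 1) * m) :=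
              Finset.sum_congr rfl fun k hk => by rw [(Finset.mem_filter.mp hk).2]
          _ = (s.filter fun k => n k = m).card * Real.exp (K - (C + 1) * m) := by
              rw [Finset.sum_const, nsmul_eq_mul]
          _ ≤ Real.exp (C * m) * Real.exp (K - (C + 1) * m) := by
              gcongr
              exact hfiber s m
          _ = Real.exp K * Real.exp (-(m : ℝ)) := by
              rw [← Real.exp_add, ← Real.exp_add]
              ring_nf
    _ = Real.exp K * ∑ m ∈ s.image n, Real.exp (-(m : ℝ)) := by rw [Finset.mul_sum]
    _ ≤ Real.exp K * ∑' m : ℕ, Real.exp (-(m : ℝ)) := by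
        gcongr
        exact hgeom.sum_le_tsum _ fun m _ => (Real.exp_pos _).le

/-- Convergence of a series in `ℓ∞` implies pointwise convergence. -/
lemma hasSum_lp_infty_apply {α ι : Type*} {f : ι → lp (fun _ : α => ℝ) ∞}
    {φ : lp (fun _ : α => ℝ) ∞} (hf : HasSum f φ) (x : α) :
    HasSum (fun i => f i x) (φ x) :=
  hf.mapL (lp.evalCLM ℝ (fun _ : α => ℝ) ∞ x)

/-
`G` is moreover equipped with a left-invariant metric whose closed balls are finite and
grow at most exponentially; `𝓘̂` is the closure of `𝓘` in the supremum-norm topology of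
`ℓ∞(G)` (the norm topology of `lp _ ∞`), i.e. `closure (Ispan G : Set _)` below.
-/
theorem stmt11 (G : Type*) [Group G] [MetricSpace G]
    (hinv : ∀ k g h : G, dist (k * g) (k * h) = dist g h)
    (hballfin : ∀ m : ℕ, (Metric.closedBall (1 : G) m).Finite)
    (C : ℝ) (hC : 0 < C)
    (hgrowth : ∀ m : ℕ, (Nat.card (Metric.closedBall (1 : G) m) : ℝ) ≤ Real.exp (C * m))
    (F : G → G → ℝ) (C₁ C₂ : ℝ) (hC₁ : 0 < C₁) (hC₂ : 0 < C₂)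
    (hF : ∀ g h : G, |F g h| ≤ C₁ * Real.exp (-C₂ * dist g h ^ 2)) :
    ∃ Φ₁ Φ₂ : lp (fun _ : G => ℝ) ∞,
      (∀ g : G, HasSum (fun h => F h g) (Φ₁ g)) ∧
      (∀ g : G, HasSum (fun h => F g h) (Φ₂ g)) ∧
      Φ₁ - Φ₂ ∈ closure (Ispan G : Set (lp (fun _ : G => ℝ) ∞)) := by
  have hw : Summable fun k : G => C₁ * Real.exp (-C₂ * dist 1 k ^ 2) :=
    (summable_exp_neg_mul_dist_one_sq hballfin hC hgrowth hC₂).mul_left C₁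
  have hdiag : ∀ k g : G, ‖F g (g * k)‖ ≤ C₁ * Real.exp (-C₂ * dist 1 k ^ 2) := by
    intro k g
    have hdist : dist g (g * k) = dist 1 k := by simpa using hinv g 1 k
    simpa [hdist] using hF g (g * k)
  let φ : G → lp (fun _ : G => ℝ) ∞ := fun k =>
    ⟨fun g => F g (g * k), memℓp_infty ⟨_, by rintro _ ⟨g, rfl⟩; exact hdiag k g⟩⟩
  have hφ : Summable φ := .of_norm_bounded hw fun k =>
    lp.norm_le_of_forall_le (by positivity) fun g => hdiag k g
  have hψ : Summable fun k => rTranslate k⁻¹ (φ k) := .of_norm_bounded hw fun k =>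
    lp.norm_le_of_forall_le (by positivity) fun g => hdiag k (g * k⁻¹)
  refine ⟨∑' k, rTranslate k⁻¹ (φ k), ∑' k, φ k, fun g => ?_, fun g => ?_, ?_⟩
  · rw [← ((Equiv.inv G).trans (Equiv.mulLeft g)).hasSum_iff]
    convert hasSum_lp_infty_apply hψ.hasSum g using 2 with k
    change F (g * k⁻¹) g = F (g * k⁻¹) (g * k⁻¹ * k)
    rw [inv_mul_cancel_right]
  · rw [← (Equiv.mulLeft g).hasSum_iff]
    exact hasSum_lp_infty_apply hφ.hasSum g
  · refine mem_closure_of_tendsto (hψ.hasSum.sub hφ.hasSum) (.of_forall fun s => ?_)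
    refine (Ispan G).sum_mem fun k _ => ?_
    rw [← neg_sub]
    exact (Ispan G).neg_mem (Submodule.subset_span ⟨k⁻¹, φ k, rfl⟩)
end
end

section
/- Let G be a group with a left-invariant metric d whose balls B_m = {g ∈ G : d(g,1) ≤ m} are finite and satisfy |B_m| ≤ e^{Cm} for all m ∈ ℕ, for some C > 0. Then for every c > 0 there exist constants C′, c′ > 0 such that for all g, h ∈ G, ∑_{k∈G} e^{−c(d(g,k)² + d(k,h)²)} ≤ C′ e^{−c′ d(g,h)²}. -/
/-- The Gaussian decay beats the exponential growth. -/
theorem summable_exp_linear_sub_sq (C : ℝ) {b : ℝ} (hb : 0 < b) :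
    Summable fun n : ℕ => Real.exp (C * (n + 1) - b * (n : ℝ) ^ 2) := by
  refine Summable.of_nonneg_of_le (fun _ => (Real.exp_pos _).le) (fun n => ?_)
    (Real.summable_exp_neg_nat.mul_left (Real.exp (C + (C + 1) ^ 2 / (4 * b))))
  rw [← Real.exp_add]
  refine Real.exp_le_exp.2 ?_
  have hsq : (C + 1) ^ 2 / (4 * b) - (C + 1) * n + b * (n : ℝ) ^ 2
      = (C + 1 - 2 * b * n) ^ 2 / (4 * b) := by
    field_simp
    ring
  have hnonneg : 0 ≤ (C + 1 - 2 * b * n) ^ 2 / (4 * b) := by positivity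
  linarith

/-- If the balls around `x` grow at most exponentially, then Gaussians centred at `x` are
summable. -/
theorem summable_exp_neg_mul_dist_sq {X : Type*} [PseudoMetricSpace X] (x : X) {C b : ℝ}
    (hb : 0 < b) (hfin : ∀ m : ℕ, (Metric.closedBall x m).Finite)
    (hgrowth : ∀ m : ℕ, (Nat.card (Metric.closedBall x m) : ℝ) ≤ Real.exp (C * m)) :
    Summable fun y : X => Real.exp (-b * dist x y ^ 2) := by
  classical
  refine summable_of_sum_le (fun _ => (Real.exp_pos _).le)
    (c := ∑' n : ℕ, Real.exp (C * (n + 1) - b * (n : ℝ) ^ 2)) fun s => ?_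
  rw [← Finset.sum_fiberwise_of_maps_to (g := fun y => ⌊dist x y⌋₊)
    (fun y hy => Finset.mem_image_of_mem (fun y => ⌊dist x y⌋₊) hy)]
  refine le_trans (Finset.sum_le_sum fun n _ => ?_)
    ((summable_exp_linear_sub_sq C hb).sum_le_tsum _ fun _ _ => (Real.exp_pos _).le)
  have hcard : ((s.filter fun y => ⌊dist x y⌋₊ = n).card : ℝ) ≤ Real.exp (C * (n + 1)) := by
    have hle := hgrowth (n + 1)
    push_cast at hle
    refine le_trans (Nat.cast_le.2 ?_) hle
    have hfin' := hfin (n + 1)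
    push_cast at hfin'
    rw [← Set.ncard_coe_finset, Nat.card_coe_set_eq]
    refine Set.ncard_le_ncard (fun y hy => ?_) hfin'
    obtain ⟨-, rfl⟩ := Finset.mem_filter.1 (Finset.mem_coe.1 hy)
    rw [Metric.mem_closedBall']
    exact (Nat.lt_floor_add_one _).le
  calc ∑ y ∈ s with ⌊dist x y⌋₊ = n, Real.exp (-b * dist x y ^ 2)
      ≤ (s.filter fun y => ⌊dist x y⌋₊ = n).card • Real.exp (-b * (n : ℝ) ^ 2) := by
        refine Finset.sum_le_card_nsmul _ _ _ fun y hy => Real.exp_le_exp.2 ?_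
        obtain ⟨-, rfl⟩ := Finset.mem_filter.1 hy
        have hsq := pow_le_pow_left₀ (Nat.cast_nonneg _)
          (Nat.floor_le (dist_nonneg : 0 ≤ dist x y)) 2
        nlinarith
    _ ≤ Real.exp (C * (n + 1)) * Real.exp (-b * (n : ℝ) ^ 2) := by
        rw [nsmul_eq_mul]
        gcongr
    _ = Real.exp (C * (n + 1) - b * (n : ℝ) ^ 2) := by
        rw [← Real.exp_add]
        ring_nf

theorem exp_neg_mul_dist_sq_add_dist_sq_le {X : Type*} [PseudoMetricSpace X] {c : ℝ}
    (hc : 0 ≤ c) (x y z : X) :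
    Real.exp (-c * (dist x y ^ 2 + dist y z ^ 2)) ≤
      Real.exp (-(c / 2) * dist x y ^ 2) * Real.exp (-(c / 4) * dist x z ^ 2) := by
  rw [← Real.exp_add]
  refine Real.exp_le_exp.2 ?_
  have htri := pow_le_pow_left₀ dist_nonneg (dist_triangle x y z) 2
  have hsq : dist x z ^ 2 ≤ 2 * (dist x y ^ 2 + dist y z ^ 2) :=
    htri.trans add_sq_le
  nlinarith [mul_le_mul_of_nonneg_left hsq hc, mul_nonneg hc (sq_nonneg (dist y z))]

/-!
Setting: `G` is a group equipped with a left-invariant metric `dist` whose closed balls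
`B_m = {g : dist g 1 ≤ m}` are finite and satisfy the growth bound `|B_m| ≤ exp (C*m)`.
-/

theorem stmt12 (G : Type*) [Group G] [MetricSpace G]
    (hinv : ∀ k g h : G, dist (k * g) (k * h) = dist g h)
    (hballfin : ∀ m : ℕ, (Metric.closedBall (1 : G) m).Finite)
    (C : ℝ) (hC : 0 < C)
    (hgrowth : ∀ m : ℕ, (Nat.card (Metric.closedBall (1 : G) m) : ℝ) ≤ Real.exp (C * m)) :
    ∀ c > (0 : ℝ), ∃ C' > (0 : ℝ), ∃ c' > (0 : ℝ), ∀ g h : G,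
      (Summable fun k : G => Real.exp (-c * (dist g k ^ 2 + dist k h ^ 2))) ∧
      (∑' k : G, Real.exp (-c * (dist g k ^ 2 + dist k h ^ 2))) ≤
        C' * Real.exp (-c' * dist g h ^ 2) := by
  intro c hc
  have hsum := summable_exp_neg_mul_dist_sq (1 : G) (half_pos hc) hballfin hgrowth
  have htranslate (g : G) :
      (fun k : G => Real.exp (-(c / 2) * dist g k ^ 2)) ∘ Equiv.mulLeft g =
        fun k => Real.exp (-(c / 2) * dist 1 k ^ 2) := by
    funext k
    have hdist := hinv g 1 k
    rw [mul_one] at hdist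
    simp [hdist]
  refine ⟨∑' k : G, Real.exp (-(c / 2) * dist 1 k ^ 2),
    hsum.tsum_pos (fun _ => (Real.exp_pos _).le) 1 (Real.exp_pos _), c / 4, by positivity,
    fun g h => ?_⟩
  have hsum_g : Summable fun k : G => Real.exp (-(c / 2) * dist g k ^ 2) := by
    rw [← (Equiv.mulLeft g).summable_iff, htranslate]
    exact hsum
  have hbound := hsum_g.mul_right (Real.exp (-(c / 4) * dist g h ^ 2))
  have hle (k : G) := exp_neg_mul_dist_sq_add_dist_sq_le hc.le g k h
  have hsummable := Summable.of_nonneg_of_le (fun _ => (Real.exp_pos _).le) hle hbound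
  refine ⟨hsummable, (hsummable.tsum_le_tsum hle hbound).trans_eq ?_⟩
  rw [tsum_mul_right, ← htranslate g]
  congr 1
  exact ((Equiv.mulLeft g).tsum_eq fun k => Real.exp (-(c / 2) * dist g k ^ 2)).symm
end
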